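/- Let N = (V,E) be an unrooted binary phylogenetic network and T an unrooted binary phylogenetic tree, both on the same label set X with |X| ≥ 3. If N displays T then tw(D(N,T)) ≤ 2·tw(N) + 1. -/

import Mathlib

open SimpleGraph

/-- `G` has a tree decomposition of width at most `k`: a tree `t` together with
bags satisfying (tw1), (tw2) and (tw3), all of whose bags have size at most `k+1`. -/
def HasTreeDecompWidthLE {V : Type*} (G : SimpleGraph V) (k : ℕ) : Prop :=
  ∃ (n : ℕ) (t : SimpleGraph (Fin (n + 1))) (bag : Fin (n + 1) → Finset V),
    t.IsTree ∧
    (∀ v : V, ∃ i, v ∈ bag i) ∧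
    (∀ u v : V, G.Adj u v → ∃ i, u ∈ bag i ∧ v ∈ bag i) ∧
    (∀ v : V, (t.induce {i | v ∈ bag i}).Connected) ∧
    (∀ i, (bag i).card ≤ k + 1)

/-- The treewidth of a graph: the least `k` such that `G` has a tree decomposition
of width `k`. -/
noncomputable def treewidth {V : Type*} (G : SimpleGraph V) : ℕ :=
  sInf {k | HasTreeDecompWidthLE G k}

/-- An unrooted binary phylogenetic graph (tree or network) on label set `X`:
a finite connected graph whose degree-1 vertices are bijectively labelled by `X`
and all of whose other vertices have degree 3. -/
structure PhyloGraph (V : Type*) (X : Type*) where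
  graph : SimpleGraph V
  finite : Finite V
  connected : graph.Connected
  leaf : X → V
  leaf_inj : Function.Injective leaf
  leaf_deg : ∀ x : X, (graph.neighborSet (leaf x)).ncard = 1
  internal_deg : ∀ v : V, (∀ x : X, leaf x ≠ v) → (graph.neighborSet v).ncard = 3

/-- An unrooted binary phylogenetic tree on label set `X`. -/
structure PhyloTree (V : Type*) (X : Type*) extends PhyloGraph V X where
  acyclic : graph.IsAcyclic

open Classical in
/-- The map identifying a leaf of the second graph with the leaf of the first
graph carrying the same label. -/
noncomputable def mergeMap {V1 V2 X : Type*} (l1 : X → V1) (l2 : X → V2) :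
    V1 ⊕ V2 → V1 ⊕ V2
  | Sum.inl v => Sum.inl v
  | Sum.inr w => if h : ∃ x, l2 x = w then Sum.inl (l1 h.choose) else Sum.inr w

lemma mergeMap_idem {V1 V2 X : Type*} (l1 : X → V1) (l2 : X → V2) (u : V1 ⊕ V2) :
    mergeMap l1 l2 (mergeMap l1 l2 u) = mergeMap l1 l2 u := by
  classical
  cases u with
  | inl v => rfl
  | inr w =>
    by_cases h : ∃ x, l2 x = w
    · simp [mergeMap, h]
    · simp [mergeMap, h]

/-- The vertex set of the display graph: the disjoint union of the vertex sets
of the two graphs, with leaves carrying the same label identified. -/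
def DisplayVertex {V1 V2 X : Type*} (l1 : X → V1) (l2 : X → V2) : Type _ :=
  {u : V1 ⊕ V2 // mergeMap l1 l2 u = u}

/-- The canonical map from `V1 ⊕ V2` to the vertex set of the display graph. -/
noncomputable def toDisplay {V1 V2 X : Type*} (l1 : X → V1) (l2 : X → V2) (u : V1 ⊕ V2) :
    DisplayVertex l1 l2 :=
  ⟨mergeMap l1 l2 u, mergeMap_idem l1 l2 u⟩

/-- The display graph of two leaf-labelled graphs: their disjoint union with the
leaves carrying the same label identified. -/
noncomputable def displayGraph {V1 V2 X : Type*} (G1 : SimpleGraph V1) (l1 : X → V1)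
    (G2 : SimpleGraph V2) (l2 : X → V2) : SimpleGraph (DisplayVertex l1 l2) :=
  SimpleGraph.fromRel (fun a b =>
    (∃ u v : V1, G1.Adj u v ∧ a = toDisplay l1 l2 (Sum.inl u) ∧ b = toDisplay l1 l2 (Sum.inl v)) ∨
    (∃ u v : V2, G2.Adj u v ∧ a = toDisplay l1 l2 (Sum.inr u) ∧ b = toDisplay l1 l2 (Sum.inr v)))

/-- The treewidth distance between two phylogenetic trees:
`d_tw(T1,T2) = tw(D(T1,T2)) - 2`. -/
noncomputable def dtw {V1 V2 X : Type*} (T1 : PhyloTree V1 X) (T2 : PhyloTree V2 X) : ℕ :=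
  treewidth (displayGraph T1.graph T1.leaf T2.graph T2.leaf) - 2

/-- Two phylogenetic trees are compatible if there is a label-preserving
isomorphism between them. -/
def Compatible {V1 V2 X : Type*} (T1 : PhyloTree V1 X) (T2 : PhyloTree V2 X) : Prop :=
  ∃ φ : T1.graph ≃g T2.graph, ∀ x : X, φ (T1.leaf x) = T2.leaf x

/-- The graph obtained from `H` by suppressing all its degree-2 vertices: its
vertices are the vertices of `H` of degree other than 2, two of them being
adjacent iff they are joined in `H` by a path all of whose internal vertices
have degree 2. -/
def Smoothing {W : Type*} (H : SimpleGraph W) :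
    SimpleGraph {w : W // (H.neighborSet w).ncard ≠ 2} :=
  SimpleGraph.fromRel (fun a b =>
    ∃ p : H.Walk a.1 b.1, p.IsPath ∧
      ∀ x ∈ p.support, x = a.1 ∨ x = b.1 ∨ (H.neighborSet x).ncard = 2)

/-- The network `N` displays the tree `T`: `N` has a subgraph which is a
subdivision of `T` (i.e. a connected subgraph which, after suppressing its
degree-2 vertices, is label-preservingly isomorphic to `T`). -/
def Displays {V W X : Type*} (N : PhyloGraph V X) (T : PhyloTree W X) : Prop :=
  ∃ S : N.graph.Subgraph, S.coe.Connected ∧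
    ∃ e : Smoothing S.coe ≃g T.graph,
      ∀ x : X, ((e.symm (T.leaf x)).1 : S.verts).1 = N.leaf x

/-- The reticulation number `r(N) = |E| - (|V| - 1)` of a network `N`. -/
noncomputable def reticNumber {V X : Type*} (N : PhyloGraph V X) : ℕ :=
  N.graph.edgeSet.ncard - (Nat.card V - 1)

section Helpers

/-- Bags meeting a connected vertex set form a connected subtree. -/
lemma bags_connected {V I : Type*} (G : SimpleGraph V) (t : SimpleGraph I) (bag : I → Finset V)
    (h1 : ∀ v : V, ∃ i, v ∈ bag i)
    (h2 : ∀ u v : V, G.Adj u v → ∃ i, u ∈ bag i ∧ v ∈ bag i)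
    (h3 : ∀ v : V, (t.induce {i | v ∈ bag i}).Connected)
    (A : Set V) (hA : (G.induce A).Connected) (U : Set I)
    (hU : ∀ i, i ∈ U ↔ ∃ v ∈ A, v ∈ bag i) : (t.induce U).Connected := by
  have key0 : ∀ v ∈ A, ∀ i j, v ∈ bag i → v ∈ bag j → ∀ (hi : i ∈ U) (hj : j ∈ U),
      (t.induce U).Reachable ⟨i, hi⟩ ⟨j, hj⟩ := by
    intro v hv i j hi hj hiU hjU
    have hr := (h3 v).preconnected ⟨i, hi⟩ ⟨j, hj⟩
    let φ : t.induce {i | v ∈ bag i} →g t.induce U :=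
      ⟨fun x => ⟨x.1, (hU x.1).2 ⟨v, hv, x.2⟩⟩, fun {a b} h => h⟩
    exact hr.map φ
  have key : ∀ u v : A, (G.induce A).Reachable u v → ∀ i j, u.1 ∈ bag i → v.1 ∈ bag j →
      ∀ (hi : i ∈ U) (hj : j ∈ U), (t.induce U).Reachable ⟨i, hi⟩ ⟨j, hj⟩ := by
    rintro u v ⟨p⟩
    induction p with
    | nil => exact fun i j hi hj => key0 _ (Subtype.prop _) i j hi hj
    | @cons a b c h p ih =>
      intro i j hi hj hiU hjU
      obtain ⟨k, hk1, hk2⟩ := h2 a.1 b.1 h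
      have hkU : k ∈ U := (hU k).2 ⟨a.1, a.2, hk1⟩
      exact (key0 a.1 a.2 i k hi hk1 hiU hkU).trans (ih k j hk2 hj hkU hjU)
  have hne : Nonempty U := by
    obtain ⟨v⟩ := hA.nonempty
    obtain ⟨i, hi⟩ := h1 v.1
    exact ⟨⟨i, (hU i).2 ⟨v.1, v.2, hi⟩⟩⟩
  refine ⟨?_⟩
  rintro ⟨i, hi⟩ ⟨j, hj⟩
  obtain ⟨u, hu, hui⟩ := (hU i).1 hi
  obtain ⟨v, hv, hvj⟩ := (hU j).1 hj
  exact key ⟨u, hu⟩ ⟨v, hv⟩ (hA.preconnected _ _) i j hui hvj hi hj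

lemma toDisplay_inr_leaf {V W X : Type*} (l1 : X → V) (l2 : X → W)
    (hl2 : Function.Injective l2) (x : X) :
    toDisplay l1 l2 (Sum.inr (l2 x)) = toDisplay l1 l2 (Sum.inl (l1 x)) := by
  have h : ∃ y, l2 y = l2 x := ⟨x, rfl⟩
  apply Subtype.ext
  simp only [toDisplay, mergeMap]
  rw [dif_pos h, hl2 h.choose_spec]

lemma toDisplay_inr_not {V W X : Type*} (l1 : X → V) (l2 : X → W) (w : W)
    (h : ¬ ∃ x, l2 x = w) : (toDisplay l1 l2 (Sum.inr w)).1 = Sum.inr w := by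
  simp only [toDisplay, mergeMap]
  rw [dif_neg h]

/-- A minor model of the tree in the network gives a decomposition of the display graph. -/
lemma display_decomp {V W X : Type*} (G : SimpleGraph V) (T : SimpleGraph W)
    (l1 : X → V) (l2 : X → W) (hl1 : Function.Injective l1) (hl2 : Function.Injective l2)
    (g : V → Option W)
    (hg1 : ∀ w, (G.induce {v | g v = some w}).Connected)
    (hg2 : ∀ u w, T.Adj u w → ∃ a b, G.Adj a b ∧ g a = some u ∧ g b = some w)
    (hg3 : ∀ x, g (l1 x) = some (l2 x)) (k : ℕ) (hk : HasTreeDecompWidthLE G k) :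
    HasTreeDecompWidthLE (displayGraph G l1 T l2) (2 * k + 1) := by
  classical
  obtain ⟨n, t, bag, ht, h1, h2, h3, h4⟩ := hk
  let F : V → Finset (DisplayVertex l1 l2) := fun v =>
    {toDisplay l1 l2 (Sum.inl v)} ∪ ((g v).map (fun w => toDisplay l1 l2 (Sum.inr w))).toFinset
  have hF : ∀ v d, d ∈ F v ↔ d = toDisplay l1 l2 (Sum.inl v) ∨
      ∃ w, g v = some w ∧ toDisplay l1 l2 (Sum.inr w) = d := by
    intro v d
    simp [F]
  have hFc : ∀ v, (F v).card ≤ 2 := by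
    intro v
    refine (Finset.card_union_le _ _).trans ?_
    have : ((g v).map (fun w => toDisplay l1 l2 (Sum.inr w))).toFinset.card ≤ 1 := by
      cases g v <;> simp
    simpa using Nat.add_le_add_left this 1
  have hconn : ∀ d, (G.induce {v | d ∈ F v}).Connected := by
    have hw : ∀ w d, toDisplay l1 l2 (Sum.inr w) = d →
        (∀ v, d = toDisplay l1 l2 (Sum.inl v) → g v = some w) →
        (∀ v w', g v = some w' → toDisplay l1 l2 (Sum.inr w') = d → w' = w) →
        (G.induce {v | d ∈ F v}).Connected := by
      intro w d h hv hv'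
      have : {v | d ∈ F v} = {v | g v = some w} := by
        ext v
        simp only [Set.mem_setOf_eq, hF]
        constructor
        · rintro (h' | ⟨w', h', h''⟩)
          · exact hv v h'
          · rw [h', hv' v w' h' h'']
        · intro h'
          exact Or.inr ⟨w, h', h⟩
      rw [this]
      exact hg1 w
    have hinl : ∀ v v', toDisplay l1 l2 (Sum.inl v) = toDisplay l1 l2 (Sum.inl v') → v = v' := by
      intro v v' h
      exact Sum.inl.inj (congrArg Subtype.val h)
    rintro ⟨v | w, hd⟩
    · have hd' : (⟨Sum.inl v, hd⟩ : DisplayVertex l1 l2) = toDisplay l1 l2 (Sum.inl v) := rfl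
      rw [hd']
      by_cases hx : ∃ x, l1 x = v
      · obtain ⟨x, rfl⟩ := hx
        apply hw (l2 x)
        · exact toDisplay_inr_leaf l1 l2 hl2 x
        · intro v hv
          rw [← hinl _ _ hv, hg3]
        · intro v w' _ h
          by_cases hx' : ∃ y, l2 y = w'
          · obtain ⟨y, rfl⟩ := hx'
            rw [toDisplay_inr_leaf l1 l2 hl2] at h
            rw [hl1 (hinl _ _ h)]
          · have := toDisplay_inr_not l1 l2 w' hx'
            rw [h] at this
            cases this
      · have : {u | toDisplay l1 l2 (Sum.inl v) ∈ F u} = {v} := by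
          ext u
          simp only [Set.mem_setOf_eq, hF, Set.mem_singleton_iff]
          constructor
          · rintro (h' | ⟨w', h', h''⟩)
            · exact (hinl _ _ h').symm
            · by_cases hx' : ∃ y, l2 y = w'
              · obtain ⟨y, rfl⟩ := hx'
                rw [toDisplay_inr_leaf l1 l2 hl2] at h''
                exact absurd ⟨y, hinl _ _ h''⟩ hx
              · have := toDisplay_inr_not l1 l2 w' hx'
                rw [h''] at this
                cases this
          · rintro rfl
            exact Or.inl rfl
        rw [this]
        have : Nonempty ({v} : Set V) := ⟨⟨v, rfl⟩⟩
        refine ⟨?_⟩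
        rintro ⟨a, rfl⟩ ⟨b, rfl⟩
        rfl
    · have hx : ¬ ∃ x, l2 x = w := by
        intro hx
        simp only [mergeMap] at hd
        rw [dif_pos hx] at hd
        cases hd
      have hd2 := toDisplay_inr_not l1 l2 w hx
      apply hw w
      · exact Subtype.ext hd2
      · intro v hv
        have := congrArg Subtype.val hv
        cases this
      · intro v w' _ h
        by_cases hx' : ∃ y, l2 y = w'
        · obtain ⟨y, rfl⟩ := hx'
          rw [toDisplay_inr_leaf l1 l2 hl2] at h
          have := congrArg Subtype.val h
          cases this
        · have h' := toDisplay_inr_not l1 l2 w' hx'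
          rw [h] at h'
          exact (Sum.inr.inj h').symm
  refine ⟨n, t, fun i => (bag i).biUnion F, ht, ?_, ?_, ?_, ?_⟩
  · intro d
    obtain ⟨v⟩ := (hconn d).nonempty
    obtain ⟨i, hi⟩ := h1 v.1
    exact ⟨i, Finset.mem_biUnion.2 ⟨v.1, hi, v.2⟩⟩
  · have hrel : ∀ a b : DisplayVertex l1 l2, ((∃ u v : V, G.Adj u v ∧
        a = toDisplay l1 l2 (Sum.inl u) ∧ b = toDisplay l1 l2 (Sum.inl v)) ∨
        (∃ u v : W, T.Adj u v ∧ a = toDisplay l1 l2 (Sum.inr u) ∧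
          b = toDisplay l1 l2 (Sum.inr v))) →
        ∃ i, a ∈ (bag i).biUnion F ∧ b ∈ (bag i).biUnion F := by
      rintro a b (⟨u, v, h, ha, hb⟩ | ⟨u, v, h, ha, hb⟩)
      · obtain ⟨i, hu, hv⟩ := h2 u v h
        exact ⟨i, Finset.mem_biUnion.2 ⟨u, hu, (hF _ _).2 (Or.inl ha)⟩,
          Finset.mem_biUnion.2 ⟨v, hv, (hF _ _).2 (Or.inl hb)⟩⟩
      · obtain ⟨u', v', h', hu', hv'⟩ := hg2 u v h
        obtain ⟨i, hu, hv⟩ := h2 u' v' h'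
        exact ⟨i, Finset.mem_biUnion.2 ⟨u', hu, (hF _ _).2 (Or.inr ⟨u, hu', ha.symm⟩)⟩,
          Finset.mem_biUnion.2 ⟨v', hv, (hF _ _).2 (Or.inr ⟨v, hv', hb.symm⟩)⟩⟩
    intro a b hab
    rw [displayGraph, SimpleGraph.fromRel_adj] at hab
    rcases hab.2 with h | h
    · exact hrel a b h
    · obtain ⟨i, hb, ha⟩ := hrel b a h
      exact ⟨i, ha, hb⟩
  · intro d
    apply bags_connected G t bag h1 h2 h3 _ (hconn d)
    intro i
    simp only [Set.mem_setOf_eq, Finset.mem_biUnion]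
    constructor
    · rintro ⟨v, h, h'⟩
      exact ⟨v, h', h⟩
    · rintro ⟨v, h, h'⟩
      exact ⟨v, h', h⟩
  · intro i
    refine (Finset.card_biUnion_le_card_mul _ _ 2 (fun v _ => hFc v)).trans ?_
    have := h4 i
    omega

lemma exists_decomp {V : Type*} [Finite V] (G : SimpleGraph V) :
    ∃ k, HasTreeDecompWidthLE G k := by
  classical
  have := Fintype.ofFinite V
  have hsub : ∀ s : Set (Fin (0 + 1)), s.Nonempty →
      ((⊥ : SimpleGraph (Fin (0 + 1))).induce s).Connected := by
    intro s hs
    have : Nonempty s := hs.to_subtype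
    refine ⟨?_⟩
    intro a b
    have : a = b := Subtype.ext (Subsingleton.elim (α := Fin 1) a.1 b.1)
    rw [this]
  refine ⟨Fintype.card V, 0, ⊥, fun _ => Finset.univ, ⟨⟨?_⟩, ?_⟩, ?_, ?_, ?_, ?_⟩
  · intro a b
    have : a = b := Subsingleton.elim (α := Fin 1) a b
    rw [this]
  · exact SimpleGraph.isAcyclic_bot
  · exact fun v => ⟨0, Finset.mem_univ _⟩
  · exact fun u v _ => ⟨0, Finset.mem_univ _, Finset.mem_univ _⟩
  · exact fun v => hsub _ ⟨0, Finset.mem_univ _⟩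
  · intro i
    simp

/-- The essential vertices (degree other than 2) that `x` reaches through
degree-2 vertices only. -/
def reachEnds {U : Type*} (H : SimpleGraph U) (x : U) :
    Set {w : U // (H.neighborSet w).ncard ≠ 2} :=
  {a | ∃ p : H.Walk x a.1, ∀ y ∈ p.support, y = a.1 ∨ (H.neighborSet y).ncard = 2}

open Classical in
/-- A choice of an essential vertex for each vertex. -/
noncomputable def pickEnd {U : Type*} (H : SimpleGraph U) (x : U) :
    Option {w : U // (H.neighborSet w).ncard ≠ 2} :=
  if h : (reachEnds H x).Nonempty then some h.some else none

section Ends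

variable {U : Type*} {H : SimpleGraph U}

lemma pickEnd_congr {x y : U} (h : reachEnds H x = reachEnds H y) :
    pickEnd H x = pickEnd H y := by
  unfold pickEnd
  rw [h]

lemma pickEnd_mem {x : U} {a : {w : U // (H.neighborSet w).ncard ≠ 2}}
    (h : pickEnd H x = some a) : a ∈ reachEnds H x := by
  unfold pickEnd at h
  split_ifs at h with h'
  rw [← Option.some.inj h]
  exact h'.some_mem

lemma pickEnd_exists {x : U} (h : (reachEnds H x).Nonempty) : ∃ a, pickEnd H x = some a := by
  unfold pickEnd
  rw [dif_pos h]
  exact ⟨_, rfl⟩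

lemma pickEnd_self (a : {w : U // (H.neighborSet w).ncard ≠ 2}) :
    pickEnd H a.1 = some a := by
  have h : (reachEnds H a.1).Nonempty := by
    refine ⟨a, Walk.nil, ?_⟩
    intro y hy
    left
    simpa using hy
  obtain ⟨b, hb⟩ := pickEnd_exists h
  obtain ⟨p, hp⟩ := pickEnd_mem hb
  rcases hp a.1 p.start_mem_support with h' | h'
  · rw [hb, Subtype.ext h']
  · exact absurd h' a.2

lemma reachEnds_mono {x y : U} (h : H.Adj x y) (hx : (H.neighborSet x).ncard = 2) :
    reachEnds H y ⊆ reachEnds H x := by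
  rintro a ⟨p, hp⟩
  refine ⟨Walk.cons h p, ?_⟩
  intro z hz
  rw [Walk.support_cons, List.mem_cons] at hz
  rcases hz with rfl | hz
  · exact Or.inr hx
  · exact hp z hz

lemma pickEnd_adj {x y : U} (h : H.Adj x y) (hx : (H.neighborSet x).ncard = 2)
    (hy : (H.neighborSet y).ncard = 2) : pickEnd H x = pickEnd H y :=
  pickEnd_congr (Set.Subset.antisymm (reachEnds_mono h.symm hy) (reachEnds_mono h hx))

lemma fibre_reach (a : {w : U // (H.neighborSet w).ncard ≠ 2}) {x b : U} (p : H.Walk x b)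
    (hb : b = a.1)
    (hp : ∀ y ∈ p.support, y = a.1 ∨ (H.neighborSet y).ncard = 2)
    (hx : pickEnd H x = some a) :
    (H.induce {v | pickEnd H v = some a}).Reachable ⟨x, hx⟩ ⟨a.1, pickEnd_self a⟩ := by
  induction p with
  | nil =>
    subst hb
    rfl
  | @cons x y c h p ih =>
    have hp' : ∀ z ∈ p.support, z = a.1 ∨ (H.neighborSet z).ncard = 2 := by
      intro z hz
      apply hp
      rw [Walk.support_cons]
      exact List.mem_cons_of_mem _ hz
    by_cases hxa : x = a.1
    · subst hxa
      rfl
    have hx2 := (hp x (Walk.start_mem_support _)).resolve_left hxa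
    have hy : pickEnd H y = some a := by
      rcases hp' y (Walk.start_mem_support _) with h' | h'
      · rw [h', pickEnd_self]
      · rw [← pickEnd_adj h hx2 h', hx]
    have hadj : (H.induce {v | pickEnd H v = some a}).Adj ⟨x, hx⟩ ⟨y, hy⟩ := h
    exact hadj.reachable.trans (ih hb hp' hy)

lemma fibre_connected (a : {w : U // (H.neighborSet w).ncard ≠ 2}) :
    (H.induce {v | pickEnd H v = some a}).Connected := by
  have hne : Nonempty {v | pickEnd H v = some a} := ⟨⟨a.1, pickEnd_self a⟩⟩
  have key : ∀ x : {v | pickEnd H v = some a},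
      (H.induce {v | pickEnd H v = some a}).Reachable x ⟨a.1, pickEnd_self a⟩ := by
    rintro ⟨x, hx⟩
    obtain ⟨p, hp⟩ := pickEnd_mem hx
    exact fibre_reach a p rfl hp hx
  exact ⟨fun x y => (key x).trans (key y).symm⟩

lemma crossing_edge (a b : {w : U // (H.neighborSet w).ncard ≠ 2}) (hab : a ≠ b) {x c : U}
    (p : H.Walk x c) (hc : c = b.1)
    (hp : ∀ y ∈ p.support, y = b.1 ∨ (H.neighborSet y).ncard = 2)
    (hx : pickEnd H x = some a) :
    ∃ u v, H.Adj u v ∧ pickEnd H u = some a ∧ pickEnd H v = some b := by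
  induction p with
  | nil =>
    subst hc
    rw [pickEnd_self] at hx
    exact absurd (Option.some.inj hx).symm hab
  | @cons x y c h p ih =>
    have hp' : ∀ z ∈ p.support, z = b.1 ∨ (H.neighborSet z).ncard = 2 := by
      intro z hz
      apply hp
      rw [Walk.support_cons]
      exact List.mem_cons_of_mem _ hz
    have hxb : x ≠ b.1 := by
      rintro rfl
      rw [pickEnd_self] at hx
      exact absurd (Option.some.inj hx).symm hab
    have hx2 := (hp x (Walk.start_mem_support _)).resolve_left hxb
    rcases hp' y (Walk.start_mem_support _) with h' | h'
    · exact ⟨x, y, h, hx, by rw [h', pickEnd_self]⟩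
    · exact ih hc hp' (by rw [← pickEnd_adj h hx2 h', hx])

lemma smoothing_adj_of_ends {y : U} {a b : {w : U // (H.neighborSet w).ncard ≠ 2}}
    (ha : a ∈ reachEnds H y) (hb : b ∈ reachEnds H y) (hab : a ≠ b) :
    (Smoothing H).Adj a b := by
  classical
  obtain ⟨p, hp⟩ := ha
  obtain ⟨q, hq⟩ := hb
  rw [Smoothing, SimpleGraph.fromRel_adj]
  refine ⟨hab, Or.inl ⟨(p.reverse.append q).bypass, Walk.bypass_isPath _, ?_⟩⟩
  intro x hx
  have hx' := Walk.support_bypass_subset _ hx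
  rw [Walk.mem_support_append_iff, Walk.support_reverse, List.mem_reverse] at hx'
  rcases hx' with h | h
  · rcases hp x h with h | h
    · exact Or.inl h
    · exact Or.inr (Or.inr h)
  · exact Or.inr (hq x h)

lemma edge_model (hac : ∀ a b c, (Smoothing H).Adj a b → (Smoothing H).Adj b c →
      (Smoothing H).Adj a c → False)
    {a b : {w : U // (H.neighborSet w).ncard ≠ 2}} (hab : a ≠ b)
    (p : H.Walk a.1 b.1) (hp : p.IsPath)
    (hs : ∀ x ∈ p.support, x = a.1 ∨ x = b.1 ∨ (H.neighborSet x).ncard = 2) :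
    ∃ u v, H.Adj u v ∧ pickEnd H u = some a ∧ pickEnd H v = some b := by
  have key : ∀ (x c : U) (p : H.Walk x c), x = a.1 → c = b.1 → p.IsPath →
      (∀ x ∈ p.support, x = a.1 ∨ x = b.1 ∨ (H.neighborSet x).ncard = 2) →
      ∃ u v, H.Adj u v ∧ pickEnd H u = some a ∧ pickEnd H v = some b := by
    intro x c p hx hc hp hs
    cases p with
    | nil => exact absurd (Subtype.ext (hx.symm.trans hc)) hab
    | @cons _ y _ h p =>
      subst hx
      subst hc
      rw [Walk.cons_isPath_iff] at hp
      have hp' : ∀ z ∈ p.support, z = b.1 ∨ (H.neighborSet z).ncard = 2 := by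
        intro z hz
        have hz' : z ≠ a.1 := by
          rintro rfl
          exact hp.2 hz
        refine (hs z ?_).resolve_left hz'
        rw [Walk.support_cons]
        exact List.mem_cons_of_mem _ hz
      rcases hp' y (Walk.start_mem_support _) with h' | h'
      · exact ⟨a.1, y, h, pickEnd_self a, by rw [h', pickEnd_self]⟩
      · have hb : b ∈ reachEnds H y := ⟨p, hp'⟩
        have ha : a ∈ reachEnds H y :=
          reachEnds_mono h.symm h' (pickEnd_mem (pickEnd_self a))
        obtain ⟨c, hc⟩ := pickEnd_exists ⟨a, ha⟩
        have hcm := pickEnd_mem hc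
        by_cases hca : a = c
        · subst hca
          exact crossing_edge a b hab p rfl hp' hc
        by_cases hcb : b = c
        · subst hcb
          exact ⟨a.1, y, h, pickEnd_self a, hc⟩
        · exact (hac a b c (smoothing_adj_of_ends ha hb hab) (smoothing_adj_of_ends hb hcm hcb)
            (smoothing_adj_of_ends ha hcm hca)).elim
  exact key _ _ p rfl rfl hp hs

lemma edge_model_adj (hac : ∀ a b c, (Smoothing H).Adj a b → (Smoothing H).Adj b c →
      (Smoothing H).Adj a c → False)
    {a b : {w : U // (H.neighborSet w).ncard ≠ 2}} (hab : (Smoothing H).Adj a b) :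
    ∃ u v, H.Adj u v ∧ pickEnd H u = some a ∧ pickEnd H v = some b := by
  have h := hab
  rw [Smoothing, SimpleGraph.fromRel_adj] at h
  rcases h.2 with ⟨p, hp, hs⟩ | ⟨p, hp, hs⟩
  · exact edge_model hac h.1 p hp hs
  · obtain ⟨u, v, h1, h2, h3⟩ := edge_model hac h.1.symm p hp hs
    exact ⟨v, u, h1.symm, h3, h2⟩

end Ends

lemma acyclic_no_triangle {W : Type*} {T : SimpleGraph W} (hT : T.IsAcyclic) (a b c : W)
    (hab : T.Adj a b) (hbc : T.Adj b c) (hac : T.Adj a c) : False := by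
  have hp : (Walk.cons hab (Walk.cons hbc Walk.nil)).IsPath := by
    simp [Walk.cons_isPath_iff, hab.ne, hbc.ne, hac.ne]
  have hq : (Walk.cons hac Walk.nil).IsPath := by
    simp [Walk.cons_isPath_iff, hac.ne]
  have h := (hT.subsingleton_path a c).elim ⟨_, hp⟩ ⟨_, hq⟩
  have h' := congrArg (fun r : T.Path a c => r.1.length) h
  simp at h'

end Helpers

/-- If an unrooted binary phylogenetic network `N` displays an unrooted binary
phylogenetic tree `T` on the same label set `X` with `|X| ≥ 3`, then
`tw(D(N,T)) ≤ 2·tw(N) + 1`. -/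
theorem treewidth_display_le_two_tw {V W X : Type*}
    (N : PhyloGraph V X) (T : PhyloTree W X) (hX : 3 ≤ Nat.card X)
    (hdisp : Displays N T) :
    treewidth (displayGraph N.graph N.leaf T.graph T.leaf) ≤
      2 * treewidth N.graph + 1 := by
  classical
  obtain ⟨S, -, e, he⟩ := hdisp
  have := N.finite
  have hk : HasTreeDecompWidthLE N.graph (treewidth N.graph) := Nat.sInf_mem (exists_decomp N.graph)
  apply Nat.sInf_le
  have hac : ∀ a b c, (Smoothing S.coe).Adj a b → (Smoothing S.coe).Adj b c →
      (Smoothing S.coe).Adj a c → False := by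
    intro a b c h1 h2 h3
    exact acyclic_no_triangle T.acyclic (e a) (e b) (e c) (e.map_adj_iff.2 h1)
      (e.map_adj_iff.2 h2) (e.map_adj_iff.2 h3)
  let g : V → Option W := fun v =>
    if h : v ∈ S.verts then (pickEnd S.coe ⟨v, h⟩).map e else none
  have hg : ∀ v w, g v = some w ↔ ∃ h : v ∈ S.verts, pickEnd S.coe ⟨v, h⟩ = some (e.symm w) := by
    intro v w
    by_cases h : v ∈ S.verts
    · simp only [g, dif_pos h, Option.map_eq_some_iff]
      constructor
      · rintro ⟨a, ha, rfl⟩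
        exact ⟨h, by simpa using ha⟩
      · rintro ⟨_, ha⟩
        exact ⟨_, ha, by simp⟩
    · simp [g, h]
  refine display_decomp N.graph T.graph N.leaf T.leaf N.leaf_inj T.leaf_inj g ?_ ?_ ?_ _ hk
  · intro w
    have hc := fibre_connected (H := S.coe) (e.symm w)
    let φ : S.coe.induce {v | pickEnd S.coe v = some (e.symm w)} →g
        N.graph.induce {v | g v = some w} :=
      ⟨fun x => ⟨x.1.1, (hg _ _).2 ⟨x.1.2, x.2⟩⟩, fun {a b} h => S.adj_sub h⟩
    have hsurj : Function.Surjective φ := by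
      rintro ⟨v, hv⟩
      obtain ⟨h, h'⟩ := (hg _ _).1 hv
      exact ⟨⟨⟨v, h⟩, h'⟩, rfl⟩
    exact hc.map φ hsurj
  · intro u w huw
    obtain ⟨a, b, hab, ha, hb⟩ := edge_model_adj hac (e.symm.map_adj_iff.2 huw)
    exact ⟨a.1, b.1, S.adj_sub hab, (hg _ _).2 ⟨a.2, ha⟩, (hg _ _).2 ⟨b.2, hb⟩⟩
  · intro x
    rw [hg, ← he x]
    exact ⟨(e.symm (T.leaf x)).1.2, pickEnd_self _⟩
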